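/- arXiv:math/0510499 — 2 statements merged into one kernel-verified Lean document; each statement's English description precedes it below -/
import Mathlib

section
/- There exists a 9-dimensional binary linear code K ⊆ (ℤ/2)^56 all of whose nonzero words have weight in {24, 32, 56}. -/
/-- The weight of a word in `(ℤ/2)^μ`: the number of nonzero coordinates. -/
def codeWeight {μ : ℕ} (v : Fin μ → ZMod 2) : ℕ :=
  (Finset.univ.filter fun i => v i ≠ 0).card

/-- The word in `(ℤ/2)^μ` whose coordinates are the binary digits of `n`. -/
def bitWord (μ n : ℕ) : Fin μ → ZMod 2 :=
  fun i => if n.testBit i then 1 else 0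

theorem bitWord_zero (μ : ℕ) : bitWord μ 0 = 0 := by
  ext i
  simp [bitWord]

theorem bitWord_xor (μ m n : ℕ) : bitWord μ (m ^^^ n) = bitWord μ m + bitWord μ n := by
  ext i
  have h : (1 + 1 : ZMod 2) = 0 := by decide
  cases hm : m.testBit i <;> cases hn : n.testBit i <;> simp [bitWord, hm, hn, h]

theorem codeWeight_bitWord (μ n : ℕ) :
    codeWeight (bitWord μ n) = Nat.count (fun i => n.testBit i) μ := by
  rw [Nat.count_eq_card_filter_range, codeWeight, Finset.card_filter, Finset.card_filter,
    ← Fin.sum_univ_eq_sum_range (fun i => if n.testBit i = true then 1 else 0)]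
  simp [bitWord]

/-- The list of all bitwise sums of sublists of a list of natural numbers. -/
def xorSpan : List ℕ → List ℕ
  | [] => [0]
  | r :: rs => xorSpan rs ++ (xorSpan rs).map (r ^^^ ·)

theorem exists_mem_xorSpan_of_mem_span {μ : ℕ} {rs : List ℕ} {v : Fin μ → ZMod 2}
    (hv : v ∈ Submodule.span (ZMod 2) (bitWord μ '' {r | r ∈ rs})) :
    ∃ n ∈ xorSpan rs, v = bitWord μ n := by
  induction rs generalizing v with
  | nil => simpa [xorSpan, bitWord_zero] using hv
  | cons r rs ih =>
    have h : {n | n ∈ r :: rs} = insert r {n | n ∈ rs} := by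
      ext n
      simp
    rw [h, Set.image_insert_eq, Submodule.mem_span_insert] at hv
    obtain ⟨a, w, hw, rfl⟩ := hv
    obtain ⟨n, hn, rfl⟩ := ih hw
    have ha : a = 0 ∨ a = 1 := by
      revert a
      decide
    rcases ha with rfl | rfl
    · exact ⟨n, by simp [xorSpan, hn], by simp⟩
    · exact ⟨r ^^^ n, by simp [xorSpan, hn], by simp [bitWord_xor]⟩

/-- A generator matrix in systematic form, its rows written as binary numbers. The first eight
rows span the irreducible cyclic code of length `51` with check polynomial
`x⁸ + x⁴ + x³ + x + 1`, padded by zeros; the sum of all nine rows is the all-ones word. -/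
def generatorRows : List ℕ :=
  [0x6326e7b34b101, 0x256b28d5dd302, 0x4ad651abba604,
   0x768a44e43fd08, 0xe326e7b34b10, 0x1c64dcf669620,
   0x38c9b9ecd2c40, 0x719373d9a5880, 0xfdee25d6ec6f00]

/-- Coordinates on which `generatorRows` restricts to the identity matrix. -/
def informationSet : Fin 9 → Fin 56 :=
  ![0, 1, 2, 3, 4, 5, 6, 7, 55]

theorem linearIndependent_generatorRows :
    LinearIndependent (ZMod 2) fun j : Fin 9 => bitWord 56 (generatorRows.get j) := by
  have h : ∀ j k : Fin 9, bitWord 56 (generatorRows.get j) (informationSet k) =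
      if j = k then 1 else 0 := by
    decide +kernel
  refine Fintype.linearIndependent_iff.2 fun g hg k => ?_
  simpa [-List.get_eq_getElem, h] using congrFun hg (informationSet k)

theorem weight_of_mem_xorSpan_generatorRows :
    ∀ n ∈ xorSpan generatorRows,
      n = 0 ∨ Nat.count (fun i => n.testBit i) 56 ∈ [24, 32, 56] := by
  decide +kernel

/-- There exists a 9-dimensional binary linear code `K ⊆ (ℤ/2)^56`
all of whose nonzero words have weight in `{24, 32, 56}`. -/
theorem statement1 :
    ∃ K : Submodule (ZMod 2) (Fin 56 → ZMod 2),
      Module.finrank (ZMod 2) K = 9 ∧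
      ∀ v ∈ K, v ≠ 0 → codeWeight v ∈ ({24, 32, 56} : Set ℕ) := by
  refine ⟨Submodule.span (ZMod 2) (bitWord 56 '' {r | r ∈ generatorRows}), ?_, fun v hv hne => ?_⟩
  · have h : bitWord 56 '' {r | r ∈ generatorRows} =
        Set.range fun j : Fin 9 => bitWord 56 (generatorRows.get j) := by
      rw [← Set.range_list_get, ← Set.range_comp]
      rfl
    rw [h, finrank_span_eq_card linearIndependent_generatorRows, Fintype.card_fin]
  · obtain ⟨n, hn, rfl⟩ := exists_mem_xorSpan_of_mem_span hv
    rcases weight_of_mem_xorSpan_generatorRows n hn with rfl | h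
    · exact absurd (bitWord_zero 56) hne
    · simpa [codeWeight_bitWord] using h
end

section
/- Let R be a commutative ring, G a nonzerodivisor in R, E a free R-module of rank r with basis e₁,…,e_r, and F ⊆ E the submodule with basis G·e₁, e₂, …, e_r. Then there is an exact sequence 0 → Λ²F → F ⊗ E → S²E → (E/F) ⊗ (E/F) → 0, where the middle map sends f ⊗ e to the symmetrization f·e, and the last map is induced by the quotient. -/
open TensorProduct

noncomputable section

/-- The submodule of `M ⊗ M` generated by the antisymmetric tensors `x ⊗ y - y ⊗ x`. -/
def symRel (R M : Type*) [CommRing R] [AddCommGroup M] [Module R M] :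
    Submodule R (M ⊗[R] M) :=
  Submodule.span R {z | ∃ x y : M, z = x ⊗ₜ[R] y - y ⊗ₜ[R] x}

/-- The second symmetric power `S²M`, as the quotient of `M ⊗ M` by antisymmetric tensors. -/
abbrev Sym2Mod (R M : Type*) [CommRing R] [AddCommGroup M] [Module R M] :=
  (M ⊗[R] M) ⧸ symRel R M

/-- The wedge `a ∧ b` as an element of the second exterior power `⋀²M`. -/
def wedge2 (R : Type*) [CommRing R] {M : Type*} [AddCommGroup M] [Module R M]
    (a b : M) : ⋀[R]^2 M :=
  ⟨ExteriorAlgebra.ιMulti R 2 ![a, b],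
    ExteriorAlgebra.ιMulti_range R 2 (Set.mem_range_self _)⟩

open Module

/-- The wedge product as the value of the universal alternating map. -/
theorem wedge2_eq_iMulti (R : Type*) [CommRing R] {M : Type*} [AddCommGroup M] [Module R M]
    (a b : M) : wedge2 R a b = exteriorPower.ιMulti R 2 ![a, b] := rfl

theorem wedge2_swap (R : Type*) [CommRing R] {M : Type*} [AddCommGroup M] [Module R M]
    (a b : M) : wedge2 R b a = -wedge2 R a b := by
  have h := (exteriorPower.ιMulti R 2).map_swap ![a, b] (i := 0) (j := 1) (by decide)
  rw [wedge2_eq_iMulti, wedge2_eq_iMulti, ← h]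
  congr 1
  ext i
  fin_cases i <;> rfl

/-- Linear maps on `⋀²M` that agree on wedges of distinct basis vectors, in increasing order,
are equal. -/
theorem linearMap_ext_wedge2_basis {R M N ι : Type*} [CommRing R] [AddCommGroup M] [Module R M]
    [AddCommGroup N] [Module R N] [LinearOrder ι] (b : Basis ι R M) {g h : ⋀[R]^2 M →ₗ[R] N}
    (H : ∀ i j, i < j → g (wedge2 R (b i) (b j)) = h (wedge2 R (b i) (b j))) : g = h := by
  refine exteriorPower.linearMap_ext (b.ext_alternating fun v hv => ?_)
  have hw : exteriorPower.ιMulti R 2 (fun i => b (v i)) = wedge2 R (b (v 0)) (b (v 1)) := by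
    rw [wedge2_eq_iMulti]
    congr 1
    ext i
    fin_cases i <;> rfl
  rw [LinearMap.compAlternatingMap_apply, LinearMap.compAlternatingMap_apply, hw]
  rcases lt_or_gt_of_ne (hv.ne (show (0 : Fin 2) ≠ 1 by decide)) with hlt | hlt
  · exact H _ _ hlt
  · rw [wedge2_swap, map_neg, map_neg, H _ _ hlt]

theorem mkQ_symRel_tmul_comm {R M : Type*} [CommRing R] [AddCommGroup M] [Module R M] (x y : M) :
    (symRel R M).mkQ (x ⊗ₜ[R] y) = (symRel R M).mkQ (y ⊗ₜ[R] x) := by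
  rw [← sub_eq_zero, ← map_sub, Submodule.mkQ_apply, Submodule.Quotient.mk_eq_zero]
  exact Submodule.subset_span ⟨x, y, rfl⟩

/-- The tensors `b i ⊗ b j` of standard basis vectors, as a basis of `R^ι ⊗ R^ι`. -/
def tensorBasis (R ι : Type*) [CommRing R] [Fintype ι] [DecidableEq ι] :
    Basis (ι × ι) R ((ι → R) ⊗[R] (ι → R)) :=
  (Pi.basisFun R ι).tensorProduct (Pi.basisFun R ι)

theorem tensorBasis_apply (R : Type*) {ι : Type*} [CommRing R] [Fintype ι] [DecidableEq ι]
    (p : ι × ι) :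
    tensorBasis R ι p = Pi.basisFun R ι p.1 ⊗ₜ[R] Pi.basisFun R ι p.2 :=
  Basis.tensorProduct_apply' _ _ _

theorem tensorBasis_repr_tmul {R ι : Type*} [CommRing R] [Fintype ι] [DecidableEq ι]
    (x y : ι → R) (i j : ι) :
    (tensorBasis R ι).repr (x ⊗ₜ[R] y) (i, j) = x i * y j := by
  simp [tensorBasis, mul_comm]

theorem repr_add_repr_swap_of_mem_symRel {R ι : Type*} [CommRing R] [Fintype ι] [DecidableEq ι]
    {w : (ι → R) ⊗[R] (ι → R)} (hw : w ∈ symRel R (ι → R)) (i j : ι) :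
    (tensorBasis R ι).repr w (i, j) + (tensorBasis R ι).repr w (j, i) = 0 := by
  induction hw using Submodule.span_induction with
  | mem w h =>
    obtain ⟨x, y, rfl⟩ := h
    simp only [map_sub, Finsupp.sub_apply, tensorBasis_repr_tmul]
    ring
  | zero => simp
  | add u v _ _ hu hv =>
    simp only [map_add, Finsupp.add_apply]
    linear_combination hu + hv
  | smul a u _ hu =>
    simp only [map_smul, Finsupp.smul_apply, smul_eq_mul]
    linear_combination a * hu

theorem repr_diag_of_mem_symRel {R ι : Type*} [CommRing R] [Fintype ι] [DecidableEq ι]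
    {w : (ι → R) ⊗[R] (ι → R)} (hw : w ∈ symRel R (ι → R)) (i : ι) :
    (tensorBasis R ι).repr w (i, i) = 0 := by
  induction hw using Submodule.span_induction with
  | mem w h =>
    obtain ⟨x, y, rfl⟩ := h
    simp only [map_sub, Finsupp.sub_apply, tensorBasis_repr_tmul]
    ring
  | zero => simp
  | add u v _ _ hu hv => simp [hu, hv]
  | smul a u _ hu => simp [hu]

/-- The linear map `R^ι ⊗ R^ι → ⋀²R^ι` sending `b i ⊗ b j` to `b i ∧ b j` if `i < j`, and to `0`
otherwise. -/
def upperWedge (R ι : Type*) [CommRing R] [Fintype ι] [LinearOrder ι] :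
    (ι → R) ⊗[R] (ι → R) →ₗ[R] ⋀[R]^2 (ι → R) :=
  (tensorBasis R ι).constr R fun p =>
    if p.1 < p.2 then wedge2 R (Pi.basisFun R ι p.1) (Pi.basisFun R ι p.2) else 0

theorem upperWedge_basis (R : Type*) {ι : Type*} [CommRing R] [Fintype ι] [LinearOrder ι]
    (i j : ι) :
    upperWedge R ι (Pi.basisFun R ι i ⊗ₜ[R] Pi.basisFun R ι j) =
      if i < j then wedge2 R (Pi.basisFun R ι i) (Pi.basisFun R ι j) else 0 := by
  rw [← tensorBasis_apply R (i, j), upperWedge, Basis.constr_basis]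

theorem diagonal_basisFun {R ι : Type*} [CommRing R] [Fintype ι] [LinearOrder ι] {c : ι → R}
    {f : (ι → R) →ₗ[R] (ι → R)} (hf : ∀ v i, f v i = c i * v i) (i : ι) :
    f (Pi.basisFun R ι i) = c i • Pi.basisFun R ι i := by
  ext k
  rcases eq_or_ne k i with rfl | h <;> simp [*]

theorem antisymmetrization_basis {R ι : Type*} [CommRing R] [Fintype ι] [LinearOrder ι]
    {c : ι → R}
    {f : (ι → R) →ₗ[R] (ι → R)} (hf : ∀ v i, f v i = c i * v i)
    {α : (⋀[R]^2 (ι → R)) →ₗ[R] ((ι → R) ⊗[R] (ι → R))}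
    (hα : ∀ a b, α (wedge2 R a b) = a ⊗ₜ[R] f b - b ⊗ₜ[R] f a)
    (i j : ι) :
    α (wedge2 R (Pi.basisFun R ι i) (Pi.basisFun R ι j)) =
      c j • tensorBasis R ι (i, j) - c i • tensorBasis R ι (j, i) := by
  simp only [hα, diagonal_basisFun hf, tensorBasis_apply, TensorProduct.tmul_smul]

theorem upperWedge_comp_antisymmetrization {R ι : Type*} [CommRing R] [Fintype ι] [LinearOrder ι]
    {c : ι → R}
    {f : (ι → R) →ₗ[R] (ι → R)} (hf : ∀ v i, f v i = c i * v i)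
    {α : (⋀[R]^2 (ι → R)) →ₗ[R] ((ι → R) ⊗[R] (ι → R))}
    (hα : ∀ a b, α (wedge2 R a b) = a ⊗ₜ[R] f b - b ⊗ₜ[R] f a)
    (hc : ∀ i j, i < j → c j = 1) : upperWedge R ι ∘ₗ α = LinearMap.id := by
  refine linearMap_ext_wedge2_basis (Pi.basisFun R ι) fun i j hij => ?_
  simp [antisymmetrization_basis hf hα, tensorBasis_apply, upperWedge_basis, hij, hij.not_gt,
    hc i j hij, -Pi.basisFun_apply]

theorem repr_antisymmetrization_upperWedge {R ι : Type*} [CommRing R] [Fintype ι] [LinearOrder ι]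
    {c : ι → R}
    {f : (ι → R) →ₗ[R] (ι → R)} (hf : ∀ v i, f v i = c i * v i)
    {α : (⋀[R]^2 (ι → R)) →ₗ[R] ((ι → R) ⊗[R] (ι → R))}
    (hα : ∀ a b, α (wedge2 R a b) = a ⊗ₜ[R] f b - b ⊗ₜ[R] f a)
    (hc : ∀ i j, i < j → c j = 1) (z : (ι → R) ⊗[R] (ι → R)) (k l : ι) :
    (tensorBasis R ι).repr (α (upperWedge R ι z)) (k, l) =
      if k < l then (tensorBasis R ι).repr z (k, l)
      else if l < k then -(c l * (tensorBasis R ι).repr z (l, k)) else 0 := by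
  let φ : (ι → R) ⊗[R] (ι → R) →ₗ[R] R :=
    if k < l then (tensorBasis R ι).coord (k, l)
    else if l < k then -(c l • (tensorBasis R ι).coord (l, k)) else 0
  have h : (tensorBasis R ι).coord (k, l) ∘ₗ α ∘ₗ upperWedge R ι = φ := by
    refine (tensorBasis R ι).ext fun ⟨i, j⟩ => ?_
    rw [LinearMap.comp_apply, LinearMap.comp_apply, tensorBasis_apply, upperWedge_basis,
      ← tensorBasis_apply R (i, j)]
    rcases lt_or_ge i j with hij | hij
    · simp only [φ, hij, if_true, antisymmetrization_basis hf hα, hc i j hij]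
      split_ifs with h₁ h₂ <;>
        simp [Finsupp.single_apply] <;> grind
    · simp only [φ, hij.not_gt, if_false, map_zero]
      split_ifs with h₁ h₂ <;>
        simp [Finsupp.single_apply] <;> grind
  have hz := LinearMap.congr_fun h z
  simp only [φ] at hz
  split_ifs at hz ⊢ <;> simpa using hz

theorem repr_map_diagonal {R ι : Type*} [CommRing R] [Fintype ι] [LinearOrder ι] {c : ι → R}
    {f : (ι → R) →ₗ[R] (ι → R)} (hf : ∀ v i, f v i = c i * v i)
    (z : (ι → R) ⊗[R] (ι → R)) (i j : ι) :
    (tensorBasis R ι).repr (f.rTensor (ι → R) z) (i, j) =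
      c i * (tensorBasis R ι).repr z (i, j) := by
  induction z with
  | zero => simp
  | tmul x y => simp [tensorBasis_repr_tmul, hf, mul_assoc]
  | add x y hx hy => simp only [map_add, Finsupp.add_apply, hx, hy, mul_add]

/-- Tensors whose symmetrization vanishes are antisymmetrizations. -/
theorem antisymmetrization_upperWedge_eq_self {R ι : Type*} [CommRing R] [Fintype ι] [LinearOrder ι]
    {c : ι → R}
    {f : (ι → R) →ₗ[R] (ι → R)} (hf : ∀ v i, f v i = c i * v i)
    {α : (⋀[R]^2 (ι → R)) →ₗ[R] ((ι → R) ⊗[R] (ι → R))}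
    (hα : ∀ a b, α (wedge2 R a b) = a ⊗ₜ[R] f b - b ⊗ₜ[R] f a)
    (hc : ∀ i j, i < j → c j = 1) (hreg : ∀ i, c i ∈ nonZeroDivisors R)
    {z : (ι → R) ⊗[R] (ι → R)} (hz : f.rTensor (ι → R) z ∈ symRel R (ι → R)) :
    α (upperWedge R ι z) = z := by
  refine (tensorBasis R ι).ext_elem fun ⟨k, l⟩ => ?_
  rw [repr_antisymmetrization_upperWedge hf hα hc]
  rcases lt_trichotomy k l with h | rfl | h
  · simp [h]
  · have hk := repr_diag_of_mem_symRel hz k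
    rw [repr_map_diagonal hf] at hk
    simpa using ((mul_left_mem_nonZeroDivisors_eq_zero_iff (hreg k)).1 hk).symm
  · have hkl := repr_add_repr_swap_of_mem_symRel hz k l
    rw [repr_map_diagonal hf, repr_map_diagonal hf, hc l k h] at hkl
    rw [if_neg h.not_gt, if_pos h]
    linear_combination -hkl

/-- The sequence `N ⊗ M → S²M → (M/f(N)) ⊗ (M/f(N))` is exact, for any linear map `f : N → M`. -/
theorem exact_symmetrization_quotient {R M N : Type*} [CommRing R]
    [AddCommGroup M] [Module R M] [AddCommGroup N] [Module R N] (f : N →ₗ[R] M)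
    {β : N ⊗[R] M →ₗ[R] Sym2Mod R M}
    (hβ : ∀ a e, β (a ⊗ₜ[R] e) = (symRel R M).mkQ (f a ⊗ₜ[R] e))
    {γ : Sym2Mod R M →ₗ[R] ((M ⧸ LinearMap.range f) ⊗[R] (M ⧸ LinearMap.range f))}
    (hγ : γ ∘ₗ (symRel R M).mkQ =
      TensorProduct.map (LinearMap.range f).mkQ (LinearMap.range f).mkQ) :
    Function.Exact β γ := by
  have hex : Function.Exact f (LinearMap.range f).mkQ := LinearMap.exact_map_mkQ_range f
  have hsurj := (LinearMap.range f).mkQ_surjective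
  have hβ' : β = (symRel R M).mkQ ∘ₗ f.rTensor M := TensorProduct.ext' hβ
  have hcomm : (symRel R M).mkQ ∘ₗ f.lTensor M =
      β ∘ₗ (TensorProduct.comm R M N).toLinearMap :=
    TensorProduct.ext' fun x a => by simpa [hβ] using mkQ_symRel_tmul_comm x (f a)
  intro s
  obtain ⟨z, rfl⟩ := (symRel R M).mkQ_surjective s
  rw [← LinearMap.comp_apply, hγ, ← LinearMap.mem_ker, TensorProduct.map_ker hex hsurj hex hsurj]
  constructor
  · intro hz
    obtain ⟨_, ⟨u, rfl⟩, _, ⟨v, rfl⟩, rfl⟩ := Submodule.mem_sup.1 hz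
    refine ⟨TensorProduct.comm R M N u + v, ?_⟩
    rw [map_add, map_add]
    congr 1
    · exact (LinearMap.congr_fun hcomm u).symm
    · rw [hβ', LinearMap.comp_apply]
  · rintro ⟨v, hv⟩
    rw [← TensorProduct.map_ker hex hsurj hex hsurj, LinearMap.mem_ker, ← hγ,
      LinearMap.comp_apply, ← hv, hβ', LinearMap.comp_apply, ← LinearMap.comp_apply γ, hγ,
      ← LinearMap.comp_apply, LinearMap.rTensor, ← TensorProduct.map_comp,
      hex.linearMap_comp_eq_zero, TensorProduct.map_zero_left, LinearMap.zero_apply]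

/-- Let `R` be a commutative ring, `G` a nonzerodivisor, `E = R^r` free with
basis `e₁,…,e_r`, and `F ⊆ E` the submodule with basis `G·e₁, e₂,…,e_r` (realized as the
image of the injective map `f` multiplying the first coordinate by `G`).  Then the
sequence `0 → Λ²F → F ⊗ E → S²E → (E/F) ⊗ (E/F) → 0` is exact, where the maps are
the antisymmetrization `x∧y ↦ x⊗y − y⊗x`, the symmetrization `f⊗e ↦ f·e`, and the map
induced by the quotient `E → E/F`. -/
theorem statement9 (R : Type*) [CommRing R] (G : R) (hG : G ∈ nonZeroDivisors R)
    (r : ℕ) [NeZero r]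
    (f : (Fin r → R) →ₗ[R] (Fin r → R))
    (hf : ∀ v i, f v i = if i = 0 then G * v i else v i)
    (α : (⋀[R]^2 (Fin r → R)) →ₗ[R] ((Fin r → R) ⊗[R] (Fin r → R)))
    (hα : ∀ a b : Fin r → R,
      α (wedge2 R a b) = a ⊗ₜ[R] f b - b ⊗ₜ[R] f a)
    (β : ((Fin r → R) ⊗[R] (Fin r → R)) →ₗ[R] Sym2Mod R (Fin r → R))
    (hβ : ∀ (a e : Fin r → R),
      β (a ⊗ₜ[R] e) = (symRel R (Fin r → R)).mkQ (f a ⊗ₜ[R] e))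
    (γ : Sym2Mod R (Fin r → R) →ₗ[R]
      (((Fin r → R) ⧸ LinearMap.range f) ⊗[R] ((Fin r → R) ⧸ LinearMap.range f)))
    (hγ : ∀ x y : Fin r → R,
      γ ((symRel R (Fin r → R)).mkQ (x ⊗ₜ[R] y)) =
        Submodule.Quotient.mk x ⊗ₜ[R] Submodule.Quotient.mk y) :
    Function.Injective α ∧ Function.Exact α β ∧ Function.Exact β γ ∧
      Function.Surjective γ := by
  let c : Fin r → R := fun i => if i = 0 then G else 1
  have hf' : ∀ v i, f v i = c i * v i := fun v i => by
    rw [hf]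
    by_cases h : i = 0 <;> simp [c, h]
  have hc : ∀ i j, i < j → c j = 1 := fun i j hij =>
    if_neg ((Fin.zero_le i).trans_lt hij).ne'
  have hreg : ∀ i, c i ∈ nonZeroDivisors R := fun i => by
    by_cases h : i = 0 <;> simp [c, h, hG, one_mem]
  have hγ' : γ ∘ₗ (symRel R (Fin r → R)).mkQ =
      TensorProduct.map (LinearMap.range f).mkQ (LinearMap.range f).mkQ :=
    TensorProduct.ext' hγ
  have hβ' : β = (symRel R (Fin r → R)).mkQ ∘ₗ f.rTensor (Fin r → R) := TensorProduct.ext' hβ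
  have hβα : β ∘ₗ α = 0 := linearMap_ext_wedge2_basis (Pi.basisFun R (Fin r)) fun i j _ => by
    rw [LinearMap.comp_apply, hα, map_sub, hβ, hβ, mkQ_symRel_tmul_comm, sub_self,
      LinearMap.zero_apply]
  refine ⟨?_, fun z => ⟨fun hz => ⟨upperWedge R (Fin r) z, ?_⟩, ?_⟩,
    exact_symmetrization_quotient f hβ hγ', ?_⟩
  · exact Function.LeftInverse.injective (g := upperWedge R (Fin r))
      (LinearMap.congr_fun (upperWedge_comp_antisymmetrization hf' hα hc))
  · refine antisymmetrization_upperWedge_eq_self hf' hα hc hreg ?_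
    rwa [hβ', LinearMap.comp_apply, Submodule.mkQ_apply, Submodule.Quotient.mk_eq_zero] at hz
  · rintro ⟨w, rfl⟩
    exact LinearMap.congr_fun hβα w
  · refine Function.Surjective.of_comp (g := (symRel R (Fin r → R)).mkQ) ?_
    rw [← LinearMap.coe_comp, hγ']
    exact TensorProduct.map_surjective (Submodule.mkQ_surjective _) (Submodule.mkQ_surjective _)

end
end
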